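/- arXiv:1612.01765 — 2 statements merged into one kernel-verified Lean document; each statement's English description precedes it below -/
import Mathlib

section
/- Let k, m, n be positive integers, let A_{ij} (for i = 1,...,k and j = 1,...,m) be n×n matrices with nonnegative real entries, and let α₁,...,αₘ be positive real numbers with α₁ + ⋯ + αₘ ≥ 1. Then ρ((A₁₁^(α₁) ∘ ⋯ ∘ A₁ₘ^(αₘ)) ⋯ (A_{k1}^(α₁) ∘ ⋯ ∘ A_{km}^(αₘ))) ≤ ρ(A₁₁A₂₁⋯A_{k1})^{α₁} ⋯ ρ(A₁ₘA₂ₘ⋯A_{km})^{αₘ}. -/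
open scoped ENNReal NNReal BigOperators

/-- Spectral radius of a real matrix: the spectral radius of the corresponding
complex matrix (equivalently, the maximum modulus of its complex eigenvalues). -/
noncomputable def specRad {n : ℕ} (A : Matrix (Fin n) (Fin n) ℝ) : ℝ≥0∞ :=
  spectralRadius ℂ (A.map (fun x => (x : ℂ)))

/-- Operator norm of a real `n × n` matrix induced by the Euclidean norm on `ℝⁿ`. -/
noncomputable def opNorm {n : ℕ} (A : Matrix (Fin n) (Fin n) ℝ) : ℝ :=
  ‖LinearMap.toContinuousLinearMap (Matrix.toEuclideanLin A)‖

/-- The weighted Hadamard (Schur) geometric mean `A₁^(α₁) ∘ ⋯ ∘ Aₘ^(αₘ)`. -/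
noncomputable def hadWMean {n m : ℕ} (α : Fin m → ℝ)
    (A : Fin m → Matrix (Fin n) (Fin n) ℝ) : Matrix (Fin n) (Fin n) ℝ :=
  Matrix.of fun x y => ∏ j, (A j x y) ^ (α j)

/-- The ordered product `A 0 * A 1 * ⋯ * A (k-1)`. -/
def matListProd {n k : ℕ} (A : Fin k → Matrix (Fin n) (Fin n) ℝ) :
    Matrix (Fin n) (Fin n) ℝ :=
  (List.ofFn A).prod

/-- The set `Σ^k` of all products of `k` elements of `S`. -/
def setPow {n : ℕ} (S : Set (Matrix (Fin n) (Fin n) ℝ)) (k : ℕ) :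
    Set (Matrix (Fin n) (Fin n) ℝ) :=
  {B | ∃ A : Fin k → Matrix (Fin n) (Fin n) ℝ, (∀ i, A i ∈ S) ∧ B = matListProd A}

/-- The set `Ψ₁ Ψ₂ ⋯ Ψₘ` of products with the `j`-th factor from `Ψ j`. -/
def setProd {n m : ℕ} (Ψ : Fin m → Set (Matrix (Fin n) (Fin n) ℝ)) :
    Set (Matrix (Fin n) (Fin n) ℝ) :=
  {B | ∃ A : Fin m → Matrix (Fin n) (Fin n) ℝ, (∀ j, A j ∈ Ψ j) ∧ B = matListProd A}

/-- The weighted Hadamard geometric mean `Ψ₁^(α₁) ∘ ⋯ ∘ Ψₘ^(αₘ)` of sets. -/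
noncomputable def setHadWMean {n m : ℕ} (α : Fin m → ℝ)
    (Ψ : Fin m → Set (Matrix (Fin n) (Fin n) ℝ)) :
    Set (Matrix (Fin n) (Fin n) ℝ) :=
  {B | ∃ A : Fin m → Matrix (Fin n) (Fin n) ℝ, (∀ j, A j ∈ Ψ j) ∧ B = hadWMean α A}

/-- The generalized spectral radius `ρ(Σ) = limsup_{k→∞} (sup_{A ∈ Σ^k} ρ(A))^{1/k}`. -/
noncomputable def genSpecRad {n : ℕ} (S : Set (Matrix (Fin n) (Fin n) ℝ)) : ℝ≥0∞ :=
  Filter.atTop.limsup fun k : ℕ => (⨆ B ∈ setPow S k, specRad B) ^ (1 / (k : ℝ))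

/-- The joint spectral radius `ρ̂(Σ) = limsup_{k→∞} (sup_{A ∈ Σ^k} ‖A‖)^{1/k}`. -/
noncomputable def jointSpecRad {n : ℕ} (S : Set (Matrix (Fin n) (Fin n) ℝ)) : ℝ≥0∞ :=
  Filter.atTop.limsup fun k : ℕ =>
    (⨆ B ∈ setPow S k, ENNReal.ofReal (opNorm B)) ^ (1 / (k : ℝ))

/-- Hölder's inequality for finitely many functions and exponents with sum at least one. -/
theorem sum_prod_rpow_le_prod_sum_rpow {ι κ : Type*} (s : Finset ι) (t : Finset κ)
    (α : κ → ℝ) (hα : ∀ j ∈ t, 0 < α j) (hαsum : 1 ≤ ∑ j ∈ t, α j) (f : κ → ι → ℝ)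
    (hf : ∀ j ∈ t, ∀ x ∈ s, 0 ≤ f j x) :
    ∑ x ∈ s, ∏ j ∈ t, f j x ^ α j ≤ ∏ j ∈ t, (∑ x ∈ s, f j x) ^ α j := by
  have hsum : ∀ j ∈ t, 0 ≤ ∑ x ∈ s, f j x := fun j hj => Finset.sum_nonneg (hf j hj)
  by_cases hzero : ∃ j ∈ t, ∑ x ∈ s, f j x = 0
  · obtain ⟨j, hj, hj0⟩ := hzero
    have hfz := (Finset.sum_eq_zero_iff_of_nonneg (hf j hj)).1 hj0
    rw [Finset.sum_eq_zero fun x hx => Finset.prod_eq_zero hj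
      (by rw [hfz x hx, Real.zero_rpow (hα j hj).ne'])]
    exact Finset.prod_nonneg fun i hi => Real.rpow_nonneg (hsum i hi) _
  · push Not at hzero
    have hpos : ∀ j ∈ t, 0 < ∑ x ∈ s, f j x := fun j hj =>
      (hsum j hj).lt_of_ne' (hzero j hj)
    set S := ∑ j ∈ t, α j with hS
    have hS0 : 0 < S := by linarith
    have hβ : ∑ j ∈ t, α j / S = 1 := by rw [← Finset.sum_div, div_self hS0.ne']
    have key : ∀ x ∈ s, ∏ j ∈ t, f j x ^ α j ≤
        (∏ j ∈ t, (∑ x ∈ s, f j x) ^ α j) * ∑ j ∈ t, α j / S * (f j x / ∑ x ∈ s, f j x) := by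
      intro x hx
      have hg : ∀ j ∈ t, 0 ≤ f j x / ∑ x ∈ s, f j x := fun j hj =>
        div_nonneg (hf j hj x hx) (hsum j hj)
      have hle : ∏ j ∈ t, (f j x / ∑ x ∈ s, f j x) ^ α j ≤
          ∑ j ∈ t, α j / S * (f j x / ∑ x ∈ s, f j x) := by
        refine le_trans (Finset.prod_le_prod (fun j hj => Real.rpow_nonneg (hg j hj) _)
          fun j hj => ?_) (Real.geom_mean_le_arith_mean_weighted t (fun j => α j / S) _
            (fun j hj => (div_pos (hα j hj) hS0).le) hβ hg)
        refine Real.rpow_le_rpow_of_exponent_ge_of_imp (hg j hj) ?_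
          (div_le_self (hα j hj).le hαsum) fun _ h => absurd h (hα j hj).ne'
        exact (div_le_one (hpos j hj)).2 (Finset.single_le_sum (hf j hj) hx)
      refine le_trans (le_of_eq ?_) (mul_le_mul_of_nonneg_left hle
        (Finset.prod_nonneg fun j hj => Real.rpow_nonneg (hsum j hj) _))
      rw [← Finset.prod_mul_distrib]
      refine Finset.prod_congr rfl fun j hj => ?_
      rw [← Real.mul_rpow (hsum j hj) (hg j hj), mul_div_cancel₀ _ (hzero j hj)]
    refine (Finset.sum_le_sum key).trans (le_of_eq ?_)
    rw [← Finset.mul_sum, Finset.sum_comm]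
    have : ∀ j ∈ t, ∑ x ∈ s, α j / S * (f j x / ∑ x ∈ s, f j x) = α j / S := fun j hj => by
      rw [← Finset.mul_sum, ← Finset.sum_div, div_self (hzero j hj), mul_one]
    rw [Finset.sum_congr rfl this, hβ, mul_one]

section EntrywiseOrder

variable {n m : ℕ}

theorem hadWMean_nonneg (α : Fin m → ℝ) {A : Fin m → Matrix (Fin n) (Fin n) ℝ}
    (hA : ∀ j x y, 0 ≤ A j x y) (x y : Fin n) : 0 ≤ hadWMean α A x y := by
  rw [hadWMean, Matrix.of_apply]
  exact Finset.prod_nonneg fun j _ => Real.rpow_nonneg (hA j x y) _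

theorem Matrix.mul_apply_nonneg {A B : Matrix (Fin n) (Fin n) ℝ} (hA : ∀ x y, 0 ≤ A x y)
    (hB : ∀ x y, 0 ≤ B x y) (x y : Fin n) : 0 ≤ (A * B) x y := by
  rw [Matrix.mul_apply]
  exact Finset.sum_nonneg fun z _ => mul_nonneg (hA x z) (hB z y)

theorem Matrix.one_apply_nonneg (x y : Fin n) : 0 ≤ (1 : Matrix (Fin n) (Fin n) ℝ) x y := by
  rw [Matrix.one_apply]
  positivity

theorem Matrix.mul_apply_le_mul_apply {A B C D : Matrix (Fin n) (Fin n) ℝ}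
    (hAC : ∀ x y, A x y ≤ C x y) (hBD : ∀ x y, B x y ≤ D x y) (hB : ∀ x y, 0 ≤ B x y)
    (hC : ∀ x y, 0 ≤ C x y) (x y : Fin n) : (A * B) x y ≤ (C * D) x y := by
  rw [Matrix.mul_apply, Matrix.mul_apply]
  exact Finset.sum_le_sum fun z _ => mul_le_mul (hAC x z) (hBD z y) (hB z y) (hC x z)

theorem hadWMean_mul_hadWMean_le {α : Fin m → ℝ} (hα : ∀ j, 0 < α j) (hαsum : 1 ≤ ∑ j, α j)
    {A B : Fin m → Matrix (Fin n) (Fin n) ℝ} (hA : ∀ j x y, 0 ≤ A j x y)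
    (hB : ∀ j x y, 0 ≤ B j x y) (x y : Fin n) :
    (hadWMean α A * hadWMean α B) x y ≤ hadWMean α (fun j => A j * B j) x y := by
  have h := sum_prod_rpow_le_prod_sum_rpow Finset.univ Finset.univ α (fun j _ => hα j) hαsum
    (fun j z => A j x z * B j z y) fun j _ z _ => mul_nonneg (hA j x z) (hB j z y)
  simp only [Matrix.mul_apply, hadWMean, Matrix.of_apply]
  refine le_trans (le_of_eq ?_) h
  refine Finset.sum_congr rfl fun z _ => ?_
  rw [← Finset.prod_mul_distrib]
  exact Finset.prod_congr rfl fun j _ => (Real.mul_rpow (hA j x z) (hB j z y)).symm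

theorem one_le_hadWMean_one (α : Fin m → ℝ) (x y : Fin n) :
    (1 : Matrix (Fin n) (Fin n) ℝ) x y ≤
      hadWMean α (fun _ => (1 : Matrix (Fin n) (Fin n) ℝ)) x y := by
  by_cases h : x = y
  · subst h
    simp [hadWMean]
  · rw [Matrix.one_apply_ne h]
    exact hadWMean_nonneg α (fun _ => Matrix.one_apply_nonneg) x y

theorem matListProd_succ {k : ℕ} (A : Fin (k + 1) → Matrix (Fin n) (Fin n) ℝ) :
    matListProd A = A 0 * matListProd fun i => A i.succ := by
  simp [matListProd, List.ofFn_succ]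

theorem matListProd_nonneg {k : ℕ} {A : Fin k → Matrix (Fin n) (Fin n) ℝ}
    (hA : ∀ i x y, 0 ≤ A i x y) (x y : Fin n) : 0 ≤ matListProd A x y := by
  induction k generalizing x y with
  | zero => simpa [matListProd] using Matrix.one_apply_nonneg x y
  | succ k ih =>
    rw [matListProd_succ]
    exact Matrix.mul_apply_nonneg (hA 0) (ih fun i => hA i.succ) x y

/-- An ordered product of matrices bounded entrywise by weighted Hadamard means is bounded by the
weighted Hadamard mean of the ordered products. -/
theorem matListProd_le_hadWMean {k : ℕ} {α : Fin m → ℝ} (hα : ∀ j, 0 < α j)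
    (hαsum : 1 ≤ ∑ j, α j) {B : Fin k → Matrix (Fin n) (Fin n) ℝ}
    {A : Fin k → Fin m → Matrix (Fin n) (Fin n) ℝ} (hB : ∀ i x y, 0 ≤ B i x y)
    (hA : ∀ i j x y, 0 ≤ A i j x y) (hBA : ∀ i x y, B i x y ≤ hadWMean α (A i) x y)
    (x y : Fin n) :
    matListProd B x y ≤ hadWMean α (fun j => matListProd fun i => A i j) x y := by
  induction k generalizing x y with
  | zero => simpa [matListProd] using one_le_hadWMean_one α x y
  | succ k ih =>
    simp only [matListProd_succ]
    exact (Matrix.mul_apply_le_mul_apply (hBA 0)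
      (ih (fun i => hB i.succ) (fun i => hA i.succ) fun i => hBA i.succ)
      (matListProd_nonneg fun i => hB i.succ) (hadWMean_nonneg α (hA 0)) x y).trans
      (hadWMean_mul_hadWMean_le hα hαsum (hA 0)
        (fun j => matListProd_nonneg fun i => hA i.succ j) x y)

theorem matListProd_const (A : Matrix (Fin n) (Fin n) ℝ) (k : ℕ) :
    matListProd (fun _ : Fin k => A) = A ^ k := by
  simp [matListProd]

end EntrywiseOrder

section RowSumNorm

attribute [local instance] Matrix.linftyOpNormedRing Matrix.linftyOpNormedAlgebra

variable {n m : ℕ}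

theorem norm_map_ofReal_le_prod_rpow {α : Fin m → ℝ} (hα : ∀ j, 0 < α j)
    (hαsum : 1 ≤ ∑ j, α j) {A : Fin m → Matrix (Fin n) (Fin n) ℝ}
    {B : Matrix (Fin n) (Fin n) ℝ} (hA : ∀ j x y, 0 ≤ A j x y) (hB : ∀ x y, 0 ≤ B x y)
    (hBA : ∀ x y, B x y ≤ hadWMean α A x y) :
    ‖B.map (fun x => (x : ℂ))‖₊ ≤ ∏ j, ‖(A j).map (fun x => (x : ℂ))‖₊ ^ α j := by
  rw [Matrix.linfty_opNNNorm_def]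
  refine Finset.sup_le fun x _ => ?_
  have hrow : ∀ j, ∑ y, A j x y ≤ ‖(A j).map (fun x => (x : ℂ))‖ := fun j => by
    have h : ∑ y, ‖(A j).map (fun x => (x : ℂ)) x y‖₊ ≤ ‖(A j).map (fun x => (x : ℂ))‖₊ := by
      rw [Matrix.linfty_opNNNorm_def]
      exact Finset.le_sup (f := fun i => ∑ y, ‖(A j).map (fun x => (x : ℂ)) i y‖₊)
        (Finset.mem_univ x)
    rw [← NNReal.coe_le_coe] at h
    simpa [abs_of_nonneg (hA j x _)] using h
  rw [← NNReal.coe_le_coe]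
  push_cast
  simp only [Matrix.map_apply, Complex.norm_real, Real.norm_eq_abs, abs_of_nonneg (hB x _)]
  calc ∑ y, B x y ≤ ∑ y, ∏ j, A j x y ^ α j := Finset.sum_le_sum fun y _ => hBA x y
    _ ≤ ∏ j, (∑ y, A j x y) ^ α j :=
      sum_prod_rpow_le_prod_sum_rpow Finset.univ Finset.univ α (fun j _ => hα j) hαsum
        (fun j y => A j x y) fun j _ y _ => hA j x y
    _ ≤ _ := Finset.prod_le_prod
      (fun j _ => Real.rpow_nonneg (Finset.sum_nonneg fun y _ => hA j x y) _)
      fun j _ => Real.rpow_le_rpow (Finset.sum_nonneg fun y _ => hA j x y) (hrow j) (hα j).le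

theorem tendsto_norm_map_pow_specRad (A : Matrix (Fin n) (Fin n) ℝ) :
    Filter.Tendsto (fun N : ℕ =>
      (‖(A ^ N).map (fun x => (x : ℂ))‖₊ : ℝ≥0∞) ^ (1 / N : ℝ)) Filter.atTop
      (nhds (specRad A)) := by
  have hpow : ∀ N : ℕ, (A ^ N).map (fun x => (x : ℂ)) = (A.map fun x => (x : ℂ)) ^ N :=
    fun N => map_pow Complex.ofRealHom.mapMatrix A N
  simp only [hpow]
  exact spectrum.pow_nnnorm_pow_one_div_tendsto_nhds_spectralRadius _

theorem specRad_ne_top (A : Matrix (Fin n) (Fin n) ℝ) : specRad A ≠ ⊤ := by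
  refine ne_top_of_le_ne_top ?_ (spectrum.spectralRadius_le_pow_nnnorm_pow_one_div ℂ
    (A.map fun x => (x : ℂ)) 0)
  finiteness

theorem specRad_le_prod_rpow {α : Fin m → ℝ} (hα : ∀ j, 0 < α j)
    (hαsum : 1 ≤ ∑ j, α j) {A : Fin m → Matrix (Fin n) (Fin n) ℝ}
    {B : Matrix (Fin n) (Fin n) ℝ} (hA : ∀ j x y, 0 ≤ A j x y) (hB : ∀ x y, 0 ≤ B x y)
    (hBA : ∀ x y, B x y ≤ hadWMean α A x y) :
    specRad B ≤ ∏ j, specRad (A j) ^ α j := by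
  have hlim := ENNReal.tendsto_finsetProd_of_ne_top Finset.univ
    (fun j _ => (ENNReal.continuous_rpow_const.tendsto _).comp
      (tendsto_norm_map_pow_specRad (A j)) : ∀ j ∈ Finset.univ, Filter.Tendsto _ _
        (nhds (specRad (A j) ^ α j)))
    fun j _ => ENNReal.rpow_ne_top_of_nonneg (hα j).le (specRad_ne_top (A j))
  refine le_of_tendsto_of_tendsto' (tendsto_norm_map_pow_specRad B) hlim fun N => ?_
  have hN : ‖(B ^ N).map (fun x => (x : ℂ))‖₊ ≤
      ∏ j, ‖(A j ^ N).map (fun x => (x : ℂ))‖₊ ^ α j := by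
    simp only [← matListProd_const]
    exact norm_map_ofReal_le_prod_rpow hα hαsum
      (fun j => matListProd_nonneg fun _ => hA j) (matListProd_nonneg fun _ => hB)
      (matListProd_le_hadWMean hα hαsum (fun _ => hB) (fun _ => hA) fun _ => hBA)
  have hN' : (‖(B ^ N).map (fun x => (x : ℂ))‖₊ : ℝ≥0∞) ≤
      ∏ j, (‖(A j ^ N).map (fun x => (x : ℂ))‖₊ : ℝ≥0∞) ^ α j := by
    refine (ENNReal.coe_le_coe.2 hN).trans (le_of_eq ?_)
    rw [ENNReal.ofNNReal_finsetProd]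
    exact Finset.prod_congr rfl fun j _ => ENNReal.coe_rpow_of_nonneg _ (hα j).le
  refine (ENNReal.rpow_le_rpow hN' (by positivity)).trans (le_of_eq ?_)
  rw [← ENNReal.prod_rpow_of_nonneg (by positivity)]
  refine Finset.prod_congr rfl fun j _ => ?_
  simp only [Function.comp_apply, ← ENNReal.rpow_mul, mul_comm]

end RowSumNorm

/-- Inequality (6) for non-negative matrices under the weaker assumption
`α₁ + ⋯ + αₘ ≥ 1`. -/
theorem hadamard_mean_prod_specRad_le_of_one_le_sum {k m n : ℕ} (hk : 0 < k)
    (hm : 0 < m) (hn : 0 < n) (A : Fin k → Fin m → Matrix (Fin n) (Fin n) ℝ)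
    (hA : ∀ i j x y, 0 ≤ A i j x y)
    (α : Fin m → ℝ) (hα : ∀ j, 0 < α j) (hαsum : 1 ≤ ∑ j, α j) :
    specRad (matListProd (fun i => hadWMean α (A i))) ≤
      ∏ j, specRad (matListProd (fun i => A i j)) ^ (α j) := by
  exact specRad_le_prod_rpow hα hαsum
    (fun j => matListProd_nonneg fun i => hA i j)
    (matListProd_nonneg fun i => hadWMean_nonneg α (hA i))
    (matListProd_le_hadWMean hα hαsum (fun i => hadWMean_nonneg α (hA i)) hA
      fun _ _ _ => le_rfl)
end

section
/- Let m, n be positive integers and let A₁, A₂, ..., Aₘ be n×n matrices with nonnegative real entries. Then ρ(A₁^(1/m) ∘ A₂^(1/m) ∘ ⋯ ∘ Aₘ^(1/m)) ≤ ρ(A₁ A₂ ⋯ Aₘ)^{1/m}. -/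
open scoped ENNReal NNReal BigOperators

/-- **Hölder's inequality** for finite families of nonnegative functions and positive weights
summing to `1`. -/
lemma sum_prod_rpow_le_prod_sum_rpow_s9 {ι κ : Type*} [Fintype ι] [Fintype κ] (w : ι → ℝ)
    (hw : ∀ i, 0 < w i) (hw1 : ∑ i, w i = 1) (f : ι → κ → ℝ) (hf : ∀ i x, 0 ≤ f i x) :
    ∑ x, ∏ i, f i x ^ w i ≤ ∏ i, (∑ x, f i x) ^ w i := by
  have hS : ∀ i, 0 ≤ ∑ x, f i x := fun i => Finset.sum_nonneg fun x _ => hf i x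
  by_cases h : ∃ i, ∑ x, f i x = 0
  · obtain ⟨i, hi⟩ := h
    have hfi : ∀ x, f i x = 0 := fun x =>
      (Finset.sum_eq_zero_iff_of_nonneg fun x _ => hf i x).1 hi x (Finset.mem_univ x)
    rw [Finset.sum_eq_zero fun x _ => Finset.prod_eq_zero (Finset.mem_univ i)
      (by rw [hfi x, Real.zero_rpow (hw i).ne'])]
    exact Finset.prod_nonneg fun i _ => Real.rpow_nonneg (hS i) _
  · push Not at h
    calc ∑ x, ∏ i, f i x ^ w i
        = ∑ x, (∏ i, (∑ x, f i x) ^ w i) * ∏ i, (f i x / ∑ x, f i x) ^ w i := by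
          refine Finset.sum_congr rfl fun x _ => ?_
          rw [← Finset.prod_mul_distrib]
          refine Finset.prod_congr rfl fun i _ => ?_
          rw [← Real.mul_rpow (hS i) (div_nonneg (hf i x) (hS i)), mul_div_cancel₀ _ (h i)]
      _ ≤ ∑ x, (∏ i, (∑ x, f i x) ^ w i) * ∑ i, w i * (f i x / ∑ x, f i x) := by
          refine Finset.sum_le_sum fun x _ => mul_le_mul_of_nonneg_left ?_
            (Finset.prod_nonneg fun i _ => Real.rpow_nonneg (hS i) _)
          exact Real.geom_mean_le_arith_mean_weighted _ _ _ (fun i _ => (hw i).le) hw1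
            fun i _ => div_nonneg (hf i x) (hS i)
      _ = ∏ i, (∑ x, f i x) ^ w i := by
          rw [← Finset.mul_sum, Finset.sum_comm]
          have : ∀ i, ∑ x, w i * (f i x / ∑ x, f i x) = w i := fun i => by
            rw [← Finset.mul_sum, ← Finset.sum_div, div_self (h i), mul_one]
          simp only [this, hw1, mul_one]

/-- If the powers of `a` are dominated, up to a constant and a shift, by those of `b`, then the
spectral radius of `a` is at most that of `b`. -/
lemma spectralRadius_le_of_nnnorm_pow_succ_le {A : Type*} [NormedRing A] [NormedAlgebra ℂ A]
    [CompleteSpace A] (a b : A) (C : ℝ≥0) (h : ∀ k : ℕ, ‖a ^ (k + 1)‖₊ ≤ C * ‖b ^ k‖₊) :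
    spectralRadius ℂ a ≤ spectralRadius ℂ b := by
  by_contra! hlt
  obtain ⟨r, hbr, hra⟩ := ENNReal.lt_iff_exists_nnreal_btwn.1 hlt
  obtain ⟨s, hrs, hsa⟩ := ENNReal.lt_iff_exists_nnreal_btwn.1 hra
  replace hrs : r < s := by exact_mod_cast hrs
  have hs : 0 < s := pos_of_gt hrs
  set D : ℝ≥0 := C * ‖(1 : A)‖₊ with hD
  have key : ∀ᶠ k : ℕ in Filter.atTop, s ≤ D * (r / s) ^ k := by
    filter_upwards [(spectrum.pow_nnnorm_pow_one_div_tendsto_nhds_spectralRadius b).eventually_lt_const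
      hbr, Filter.eventually_gt_atTop 0] with k hk hk0
    have hk0' : (0 : ℝ) < k := by exact_mod_cast hk0
    have hb : ‖b ^ k‖₊ ≤ r ^ k := by
      have := ENNReal.rpow_le_rpow hk.le hk0'.le
      rw [← ENNReal.rpow_mul, one_div_mul_cancel hk0'.ne', ENNReal.rpow_one,
        ENNReal.rpow_natCast] at this
      exact_mod_cast this
    have h1 : s ^ (k + 1) ≤ D * r ^ k := by
      have h2 : (s : ℝ≥0∞) ^ (k + 1) ≤ ‖a ^ (k + 1)‖₊ * ‖(1 : A)‖₊ := by
        calc (s : ℝ≥0∞) ^ (k + 1) ≤ spectralRadius ℂ a ^ (k + 1) := by gcongr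
          _ ≤ spectralRadius ℂ (a ^ (k + 1)) := spectrum.spectralRadius_pow_le a _ k.succ_ne_zero
          _ ≤ _ := by simpa using spectrum.spectralRadius_le_pow_nnnorm_pow_one_div ℂ (a ^ (k + 1)) 0
      calc s ^ (k + 1) ≤ ‖a ^ (k + 1)‖₊ * ‖(1 : A)‖₊ := by exact_mod_cast h2
        _ ≤ (C * r ^ k) * ‖(1 : A)‖₊ := by
          gcongr
          exact (h k).trans (by gcongr)
        _ = D * r ^ k := by rw [hD]; ring
    rw [div_pow, ← mul_div_assoc, le_div_iff₀ (pow_pos hs k), ← pow_succ']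
    exact h1
  have hlim : Filter.Tendsto (fun k : ℕ => D * (r / s) ^ k) Filter.atTop (nhds 0) := by
    simpa using (NNReal.tendsto_pow_atTop_nhds_zero_of_lt_one
      (NNReal.div_lt_one_of_lt hrs)).const_mul D
  exact hs.not_ge (ge_of_tendsto hlim key)

/-- The product `a s * a (s + 1) * ⋯ * a (s + L - 1)` of consecutive terms of a sequence. -/
def windowProd {M : Type*} [Monoid M] (a : ℕ → M) (s : ℕ) : ℕ → M
  | 0 => 1
  | L + 1 => windowProd a s L * a (s + L)

section windowProd

variable {M : Type*} [Monoid M] (a : ℕ → M)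

lemma windowProd_add (s L K : ℕ) :
    windowProd a s (L + K) = windowProd a s L * windowProd a (s + L) K := by
  induction K with
  | zero => simp [windowProd]
  | succ K ih => rw [← add_assoc, windowProd, ih, windowProd, mul_assoc, add_assoc]

lemma windowProd_zero_eq_prod_ofFn (L : ℕ) :
    windowProd a 0 L = (List.ofFn fun i : Fin L => a i).prod := by
  induction L with
  | zero => simp [windowProd]
  | succ L ih => simp [windowProd, ih, List.ofFn_succ_last, -List.ofFn_succ]

lemma windowProd_add_period {m : ℕ} (ha : ∀ i, a (i + m) = a i) (s L : ℕ) :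
    windowProd a (s + m) L = windowProd a s L := by
  induction L with
  | zero => rfl
  | succ L ih => rw [windowProd, windowProd, ih, add_right_comm, ha]

lemma windowProd_period_mul {m : ℕ} (ha : ∀ i, a (i + m) = a i) (k : ℕ) :
    windowProd a m (m * k) = windowProd a 0 m ^ k := by
  induction k with
  | zero => simp [windowProd]
  | succ k ih =>
    rw [mul_add_one, add_comm, windowProd_add, windowProd_add_period a ha, ih, pow_succ']
    congr 1
    simpa using windowProd_add_period a ha 0 m

lemma windowProd_period_add_mul {m : ℕ} (ha : ∀ i, a (i + m) = a i) (k s : ℕ) :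
    windowProd a (m + m * k) s = windowProd a 0 s := by
  induction k with
  | zero => simpa using windowProd_add_period a ha 0 s
  | succ k ih => rw [mul_add_one, ← add_assoc, windowProd_add_period a ha, ih]

lemma windowProd_eq_mul_pow_mul {m : ℕ} (ha : ∀ i, a (i + m) = a i) {s : ℕ} (hs : s ≤ m)
    (k : ℕ) : windowProd a s (m * (k + 1)) =
      windowProd a s (m - s) * windowProd a 0 m ^ k * windowProd a 0 s := by
  have h : m * (k + 1) = (m - s) + (m * k + s) := by rw [mul_add_one]; omega
  rw [h, windowProd_add, windowProd_add, Nat.add_sub_cancel' hs, windowProd_period_mul a ha,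
    windowProd_period_add_mul a ha, mul_assoc]

end windowProd

lemma windowProd_apply_nonneg {n : ℕ} (a : ℕ → Matrix (Fin n) (Fin n) ℝ) (ha : ∀ i x y, 0 ≤ a i x y)
    (s L : ℕ) (x y : Fin n) : 0 ≤ windowProd a s L x y := by
  induction L generalizing x y with
  | zero =>
    rw [windowProd, Matrix.one_apply]
    split_ifs <;> norm_num
  | succ L ih =>
    rw [windowProd, Matrix.mul_apply]
    exact Finset.sum_nonneg fun z _ => mul_nonneg (ih x z) (ha _ z y)

section

variable {n m : ℕ} (A : Fin m → Matrix (Fin n) (Fin n) ℝ)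

lemma hadWMean_pow_apply_nonneg (hA : ∀ j x y, 0 ≤ A j x y) (α : Fin m → ℝ) (L : ℕ)
    (x y : Fin n) : 0 ≤ (hadWMean α A ^ L) x y := by
  induction L generalizing x y with
  | zero =>
    rw [pow_zero, Matrix.one_apply]
    split_ifs <;> norm_num
  | succ L ih =>
    rw [pow_succ, Matrix.mul_apply]
    refine Finset.sum_nonneg fun z _ => mul_nonneg (ih x z) ?_
    rw [hadWMean, Matrix.of_apply]
    exact Finset.prod_nonneg fun j _ => Real.rpow_nonneg (hA j z y) _

/-- The powers of the Hadamard geometric mean are dominated entrywise by the Hadamard geometric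
mean of the cyclically shifted products. -/
lemma hadWMean_pow_apply_le [NeZero m] (hA : ∀ j x y, 0 ≤ A j x y) (L : ℕ) (x y : Fin n) :
    (hadWMean (fun _ => 1 / (m : ℝ)) A ^ L) x y ≤
      ∏ j : Fin m, (windowProd (fun i => A (Fin.ofNat m i)) j L x y) ^ (1 / (m : ℝ)) := by
  have hm : (0 : ℝ) < m := by exact_mod_cast Nat.pos_of_neZero m
  set a : ℕ → Matrix (Fin n) (Fin n) ℝ := fun i => A (Fin.ofNat m i) with ha
  have ha0 : ∀ i x y, 0 ≤ a i x y := fun i => hA _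
  induction L generalizing x y with
  | zero =>
    by_cases hxy : x = y
    · subst hxy; simp [windowProd]
    · rw [pow_zero, Matrix.one_apply_ne hxy]
      exact Finset.prod_nonneg fun j _ => Real.rpow_nonneg (windowProd_apply_nonneg a ha0 _ _ _ _) _
  | succ L ih =>
    have hH : ∀ z, hadWMean (fun _ => 1 / (m : ℝ)) A z y =
        ∏ j : Fin m, a (j + L) z y ^ (1 / (m : ℝ)) := fun z => by
      rw [hadWMean, Matrix.of_apply, ← Equiv.prod_comp (Equiv.addRight (Fin.ofNat m L))]
      refine Finset.prod_congr rfl fun j _ => ?_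
      have : Fin.ofNat m (j + L) = j + Fin.ofNat m L := by
        ext; simp [Fin.val_add]
      simp only [ha, this, Equiv.coe_addRight]
    rw [pow_succ, Matrix.mul_apply]
    calc _ ≤ ∑ z, ∏ j : Fin m, (windowProd a j L x z * a (j + L) z y) ^ (1 / (m : ℝ)) := by
          refine Finset.sum_le_sum fun z _ => ?_
          rw [hH z]
          refine (mul_le_mul_of_nonneg_right (ih x z)
            (Finset.prod_nonneg fun j _ => Real.rpow_nonneg (ha0 _ _ _) _)).trans_eq ?_
          rw [← Finset.prod_mul_distrib]
          exact Finset.prod_congr rfl fun j _ =>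
            (Real.mul_rpow (windowProd_apply_nonneg a ha0 _ _ _ _) (ha0 _ _ _)).symm
      _ ≤ _ := sum_prod_rpow_le_prod_sum_rpow_s9 _ (fun _ => by positivity)
          (by simp [hm.ne']) _
          fun j z => mul_nonneg (windowProd_apply_nonneg a ha0 _ _ _ _) (ha0 _ _ _)

end

attribute [local instance] Matrix.linftyOpNormedRing Matrix.linftyOpNormedAlgebra

lemma Matrix.nnnorm_apply_le_linfty_opNNNorm {n : ℕ} (B : Matrix (Fin n) (Fin n) ℝ)
    (x y : Fin n) : ‖B x y‖₊ ≤ ‖B‖₊ := by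
  rw [Matrix.linfty_opNNNorm_def]
  exact (Finset.single_le_sum (f := fun y => ‖B x y‖₊) (fun _ _ => zero_le)
    (Finset.mem_univ y)).trans
    (Finset.le_sup (f := fun x => ∑ y, ‖B x y‖₊) (Finset.mem_univ x))

lemma Matrix.linfty_opNNNorm_le_card_mul {n : ℕ} (B : Matrix (Fin n) (Fin n) ℝ) (c : ℝ≥0)
    (h : ∀ x y, ‖B x y‖₊ ≤ c) : ‖B‖₊ ≤ n * c := by
  rw [Matrix.linfty_opNNNorm_def]
  refine Finset.sup_le fun x _ => (Finset.sum_le_sum fun y _ => h x y).trans_eq ?_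
  simp

lemma Matrix.linfty_opNNNorm_map_ofReal {n : ℕ} (B : Matrix (Fin n) (Fin n) ℝ) :
    ‖B.map (fun x => (x : ℂ))‖₊ = ‖B‖₊ := by
  simp [Matrix.linfty_opNNNorm_def]

lemma Matrix.map_ofReal_pow {n : ℕ} (B : Matrix (Fin n) (Fin n) ℝ) (k : ℕ) :
    (B ^ k).map (fun x => (x : ℂ)) = B.map (fun x => (x : ℂ)) ^ k :=
  map_pow (Complex.ofRealHom.mapMatrix (m := Fin n)) B k

lemma nnnorm_hadWMean_pow_mul_le {m n : ℕ} [NeZero m] (A : Fin m → Matrix (Fin n) (Fin n) ℝ)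
    (hA : ∀ j x y, 0 ≤ A j x y) : ∃ C : ℝ≥0, ∀ k : ℕ,
      ‖hadWMean (fun _ => 1 / (m : ℝ)) A ^ (m * (k + 1))‖₊ ≤ C * ‖matListProd A ^ k‖₊ := by
  have hm : (m : ℝ) ≠ 0 := by exact_mod_cast NeZero.ne m
  set a : ℕ → Matrix (Fin n) (Fin n) ℝ := fun i => A (Fin.ofNat m i) with ha
  have hper : ∀ i, a (i + m) = a i := fun i => by
    simp only [ha]; congr 1; ext; simp
  have hP : windowProd a 0 m = matListProd A := by
    rw [windowProd_zero_eq_prod_ofFn, matListProd]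
    simp [ha]
  set E : ℝ≥0 := ∑ j : Fin m, ‖windowProd a j (m - j)‖₊ * ‖windowProd a 0 j‖₊ with hE
  refine ⟨n * E, fun k => ?_⟩
  rw [mul_assoc]
  refine Matrix.linfty_opNNNorm_le_card_mul _ _ fun x y => ?_
  rw [← NNReal.coe_le_coe, coe_nnnorm, Real.norm_of_nonneg (hadWMean_pow_apply_nonneg A hA _ _ x y)]
  have hnn : ∀ j : Fin m, 0 ≤ windowProd a j (m * (k + 1)) x y :=
    fun j => windowProd_apply_nonneg a (fun i => hA _) _ _ _ _
  have hj : ∀ j : Fin m, windowProd a j (m * (k + 1)) x y ≤ (E * ‖matListProd A ^ k‖₊ : ℝ≥0) := by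
    intro j
    rw [← Real.norm_of_nonneg (hnn j), ← coe_nnnorm, NNReal.coe_le_coe]
    refine (Matrix.nnnorm_apply_le_linfty_opNNNorm _ x y).trans ?_
    rw [windowProd_eq_mul_pow_mul a hper j.2.le, hP]
    calc _ ≤ ‖windowProd a j (m - j)‖₊ * ‖matListProd A ^ k‖₊ * ‖windowProd a 0 j‖₊ :=
          (nnnorm_mul_le _ _).trans (by gcongr; exact nnnorm_mul_le _ _)
      _ = ‖windowProd a j (m - j)‖₊ * ‖windowProd a 0 j‖₊ * ‖matListProd A ^ k‖₊ := by ring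
      _ ≤ E * ‖matListProd A ^ k‖₊ := by
          gcongr
          exact Finset.single_le_sum
            (f := fun j : Fin m => ‖windowProd a j (m - j)‖₊ * ‖windowProd a 0 j‖₊)
            (fun _ _ => zero_le) (Finset.mem_univ j)
  refine (hadWMean_pow_apply_le A hA _ x y).trans ?_
  calc _ ≤ ∏ _j : Fin m, ((E * ‖matListProd A ^ k‖₊ : ℝ≥0) : ℝ) ^ (1 / (m : ℝ)) :=
        Finset.prod_le_prod (fun j _ => Real.rpow_nonneg (hnn j) _)
          fun j _ => Real.rpow_le_rpow (hnn j) (hj j) (by positivity)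
    _ = _ := by
        rw [Finset.prod_const, Finset.card_univ, Fintype.card_fin, ← Real.rpow_mul_natCast
          (NNReal.coe_nonneg _), one_div_mul_cancel hm, Real.rpow_one]

/-- Inequality (3): `ρ(A₁^(1/m) ∘ ⋯ ∘ Aₘ^(1/m)) ≤ ρ(A₁ A₂ ⋯ Aₘ)^(1/m)` for
non-negative matrices. -/
theorem specRad_hadamard_geom_mean_prod_le {m n : ℕ} (hm : 0 < m) (hn : 0 < n)
    (A : Fin m → Matrix (Fin n) (Fin n) ℝ) (hA : ∀ j x y, 0 ≤ A j x y) :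
    specRad (hadWMean (fun _ => 1 / (m : ℝ)) A) ≤
      specRad (matListProd A) ^ (1 / (m : ℝ)) := by
  have : NeZero m := ⟨hm.ne'⟩
  have hm' : (0 : ℝ) < m := by exact_mod_cast hm
  obtain ⟨C, hC⟩ := nnnorm_hadWMean_pow_mul_le A hA
  set H := hadWMean (fun _ => 1 / (m : ℝ)) A
  have h : spectralRadius ℂ (H.map (fun x => (x : ℂ)) ^ m) ≤ specRad (matListProd A) := by
    refine spectralRadius_le_of_nnnorm_pow_succ_le _ _ C fun k => ?_
    rw [← pow_mul, ← Matrix.map_ofReal_pow, ← Matrix.map_ofReal_pow,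
      Matrix.linfty_opNNNorm_map_ofReal, Matrix.linfty_opNNNorm_map_ofReal]
    exact hC k
  rw [one_div, ENNReal.le_rpow_inv_iff hm', ENNReal.rpow_natCast]
  exact (spectrum.spectralRadius_pow_le _ m hm.ne').trans h
end
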